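/- arXiv:2603.08603 — 6 statements merged into one kernel-verified Lean document; each statement's English description precedes it below -/
import Mathlib

section
/- Let R_A, R_B, P > 0, γ ∈ ℝ with P < (R_B/R_A)·e^{-γ}, and let A > 0 be the arbitrageur's holding of asset A. Define π(x) = -x·P + e^{-γ}·x·R_B/(R_A + x) and x* = √(e^{-γ}·R_A·R_B/P) − R_A. Then x* > 0 and the maximum of π over the interval [0, A] is attained exactly at min{x*, A}; that is, π(min{x*, A}) ≥ π(x) for all x ∈ [0, A], with strict inequality for x ≠ min{x*, A}. -/
open Real Set

/-- Under `P < (R_B/R_A)·e^{-γ}`, the sell-side profit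
`f(x) = -x·P + e^{-γ}·x·R_B/(R_A + x)` attains its maximum over `[0, A]`
exactly at `min{x*, A}` where `x* = √(e^{-γ}·R_A·R_B/P) − R_A > 0`. -/
theorem sell_side_optimal_trade
    (RA RB P γ A : ℝ) (hRA : 0 < RA) (hRB : 0 < RB) (hP : 0 < P)
    (hband : P < RB / RA * Real.exp (-γ)) (hA : 0 < A)
    (f : ℝ → ℝ) (hf : f = fun x => -x * P + Real.exp (-γ) * x * RB / (RA + x))
    (xstar : ℝ) (hxstar : xstar = Real.sqrt (Real.exp (-γ) * RA * RB / P) - RA) :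
    0 < xstar ∧
    (∀ x ∈ Set.Icc (0 : ℝ) A, f x ≤ f (min xstar A)) ∧
    (∀ x ∈ Set.Icc (0 : ℝ) A, x ≠ min xstar A → f x < f (min xstar A)) := by
  have hE : 0 < Real.exp (-γ) := Real.exp_pos _
  generalize Real.exp (-γ) = E at *
  obtain ⟨s, hs⟩ : ∃ s, s = Real.sqrt (E * RA * RB / P) := ⟨_, rfl⟩
  rw [← hs] at hxstar
  have hs0 : 0 ≤ s := hs ▸ Real.sqrt_nonneg _
  have hs2 : s ^ 2 * P = E * RA * RB := by
    rw [hs, Real.sq_sqrt (by positivity)]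
    field_simp
  have hband2 : P * RA < RB * E := by
    have h : RB / RA * E = RB * E / RA := by ring
    rw [h, lt_div_iff₀ hRA] at hband
    exact hband
  have hsRA : RA < s := by
    have h1 : RA ^ 2 * P < s ^ 2 * P := by
      rw [hs2]
      nlinarith [mul_lt_mul_of_pos_left hband2 hRA]
    exact lt_of_pow_lt_pow_left₀ 2 hs0 (lt_of_mul_lt_mul_right h1 hP.le)
  have hx0 : 0 < xstar := by linarith
  have hm0 : 0 < min xstar A := lt_min hx0 hA
  have hm1 : min xstar A ≤ xstar := min_le_left _ _
  have key : ∀ x ∈ Set.Icc (0 : ℝ) A, x ≠ min xstar A → f x < f (min xstar A) := by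
    intro x hx hne
    obtain ⟨hx1, hx2⟩ := hx
    have hcase : x < min xstar A ∨ (min xstar A < x ∧ min xstar A = xstar) := by
      rcases lt_or_gt_of_ne hne with h | h
      · exact Or.inl h
      · refine Or.inr ⟨h, ?_⟩
        rcases min_choice xstar A with h' | h'
        · exact h'
        · rw [h'] at h
          linarith
    generalize min xstar A = m at *
    have hp1 : 0 < RA + m := by linarith
    have hp2 : 0 < RA + x := by linarith
    have hdiff : f m - f x = (m - x) * (s ^ 2 - (RA + m) * (RA + x)) * P / ((RA + m) * (RA + x)) := by
      have h2 : (m - x) * (s ^ 2 - (RA + m) * (RA + x)) * P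
          = (m - x) * (E * RA * RB - (RA + m) * (RA + x) * P) := by
        rw [← hs2]; ring
      rw [h2, hf]
      field_simp
      ring
    have hpos : 0 < (m - x) * (s ^ 2 - (RA + m) * (RA + x)) := by
      rcases hcase with h | ⟨h, h'⟩
      · apply mul_pos (by linarith)
        have : (RA + m) * (RA + x) < s * s :=
          mul_lt_mul' (by linarith) (by linarith) hp2.le (by linarith)
        nlinarith
      · apply mul_pos_of_neg_of_neg (by linarith)
        have h3 : RA + m = s := by linarith
        rw [h3]
        have : s * s < s * (RA + x) := mul_lt_mul_of_pos_left (by linarith) (by linarith)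
        nlinarith
    have : 0 < f m - f x := by
      rw [hdiff]
      positivity
    linarith
  refine ⟨hx0, ?_, key⟩
  intro x hx
  by_cases h : x = min xstar A
  · rw [← h]
  · exact (key x hx h).le
end

section
/- Let R_A, R_B, P > 0 and γ ∈ ℝ, set K = R_A·R_B, Q₋ = R_B/R_A and m = P/Q₋. Define the post-correction reserves R_A' = √(K/(P·e^{-γ})) and R_B' = √(K·P·e^{-γ}) and the paid-out fee y_fee = (e^{γ} − 1)·(R_B' − R_B). Then (i) P·R_A' + R_B' + y_fee = R_B·(2·e^{γ/2}·√m − e^{γ} + 1); and (ii) (P·R_A' + R_B' + y_fee)/(P·R_A + R_B) − 1 = (2·e^{γ/2}·√m − m − e^{γ})/(m + 1) = −(√m − e^{γ/2})²/(m + 1), which is ≤ 0, and < 0 whenever m ≠ e^{γ}. -/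
open Real

/-- Buy-side correction value identity and proportional jump return:
with `K = R_A·R_B`, `m = P/(R_B/R_A)`, `R_A' = √(K/(P·e^{-γ}))`, `R_B' = √(K·P·e^{-γ})`
and fee `y_fee = (e^γ − 1)·(R_B' − R_B)`, the post-correction total value equals
`R_B·(2·e^{γ/2}·√m − e^γ + 1)`, and the proportional jump return equals
`(2·e^{γ/2}·√m − m − e^γ)/(m+1) = −(√m − e^{γ/2})²/(m+1) ≤ 0`, strictly negative
unless `m = e^γ`. -/
theorem buy_side_correction_jump_return
    (RA RB P γ : ℝ) (hRA : 0 < RA) (hRB : 0 < RB) (hP : 0 < P)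
    (K Qminus m RA' RB' yfee : ℝ)
    (hK : K = RA * RB) (hQ : Qminus = RB / RA) (hm : m = P / Qminus)
    (hRA' : RA' = Real.sqrt (K / (P * Real.exp (-γ))))
    (hRB' : RB' = Real.sqrt (K * (P * Real.exp (-γ))))
    (hfee : yfee = (Real.exp γ - 1) * (RB' - RB)) :
    P * RA' + RB' + yfee = RB * (2 * Real.exp (γ / 2) * Real.sqrt m - Real.exp γ + 1) ∧
    (P * RA' + RB' + yfee) / (P * RA + RB) - 1 =
      (2 * Real.exp (γ / 2) * Real.sqrt m - m - Real.exp γ) / (m + 1) ∧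
    (P * RA' + RB' + yfee) / (P * RA + RB) - 1 =
      -((Real.sqrt m - Real.exp (γ / 2)) ^ 2) / (m + 1) ∧
    (P * RA' + RB' + yfee) / (P * RA + RB) - 1 ≤ 0 ∧
    (m ≠ Real.exp γ → (P * RA' + RB' + yfee) / (P * RA + RB) - 1 < 0) := by
  have hm0 : 0 < m := by rw [hm, hQ]; positivity
  have hs : 0 < Real.sqrt m := Real.sqrt_pos.mpr hm0
  have hs2 : Real.sqrt m ^ 2 = m := Real.sq_sqrt hm0.le
  have he : 0 < Real.exp (γ / 2) := Real.exp_pos _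
  have hE : Real.exp γ = Real.exp (γ / 2) ^ 2 := by
    rw [← Real.exp_nat_mul]; congr 1; push_cast; ring
  have hPm : P = m * RB / RA := by rw [hm, hQ]; field_simp
  rw [Real.exp_neg] at hRA' hRB'
  rw [hE] at hRA' hRB' hfee ⊢
  generalize Real.exp (γ / 2) = e at *
  generalize Real.sqrt m = s at *
  have hA : RA' = RA * e / s := by
    rw [hRA', hK, hPm, ← hs2, ← Real.sqrt_sq (show 0 ≤ RA * e / s by positivity)]
    congr 1; field_simp
  have hB : RB' = RB * s / e := by
    rw [hRB', hK, hPm, ← hs2, ← Real.sqrt_sq (show 0 ≤ RB * s / e by positivity)]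
    congr 1; field_simp
  have h1 : P * RA' + RB' + yfee = RB * (2 * e * s - e ^ 2 + 1) := by
    rw [hfee, hA, hB, hPm, ← hs2]; field_simp; ring
  have hD : P * RA + RB = RB * (m + 1) := by rw [hPm]; field_simp
  have h2 : (P * RA' + RB' + yfee) / (P * RA + RB) - 1 =
      (2 * e * s - m - e ^ 2) / (m + 1) := by
    rw [h1, hD]; field_simp; ring
  have h3 : (P * RA' + RB' + yfee) / (P * RA + RB) - 1 = -((s - e) ^ 2) / (m + 1) := by
    rw [h2]; congr 1; rw [← hs2]; ring
  refine ⟨h1, h2, h3, ?_, ?_⟩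
  · rw [h3]
    exact div_nonpos_of_nonpos_of_nonneg (neg_nonpos.mpr (sq_nonneg _)) (by positivity)
  · intro hne
    rw [h3]
    have hse : s - e ≠ 0 := by
      intro h
      apply hne
      rw [← hs2, sub_eq_zero.mp h]
    exact div_neg_of_neg_of_pos (neg_lt_zero.mpr (by positivity)) (by positivity)
end

section
/- Let R_A, R_B, P > 0 and γ ∈ ℝ, set K = R_A·R_B, Q₋ = R_B/R_A and m = P/Q₋. Define the post-correction reserves R_A' = √(K/(P·e^{γ})) and R_B' = √(K·P·e^{γ}) and the paid-out fee y_fee = (1 − e^{-γ})·(R_B − R_B'). Then (i) P·R_A' + R_B' + y_fee = R_B·(2·e^{-γ/2}·√m + 1 − e^{-γ}); and (ii) (P·R_A' + R_B' + y_fee)/(P·R_A + R_B) − 1 = (2·e^{-γ/2}·√m − m − e^{-γ})/(m + 1) = −(√m − e^{-γ/2})²/(m + 1), which is ≤ 0, and < 0 whenever m ≠ e^{-γ}. -/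
open Real

/-- Sell-side correction value identity and proportional jump return:
with `K = R_A·R_B`, `m = P/(R_B/R_A)`, `R_A' = √(K/(P·e^γ))`, `R_B' = √(K·P·e^γ)`
and fee `y_fee = (1 − e^{-γ})·(R_B − R_B')`, the post-correction total value equals
`R_B·(2·e^{-γ/2}·√m + 1 − e^{-γ})`, and the proportional jump return equals
`(2·e^{-γ/2}·√m − m − e^{-γ})/(m+1) = −(√m − e^{-γ/2})²/(m+1) ≤ 0`, strictly
negative unless `m = e^{-γ}`. -/
theorem sell_side_correction_jump_return
    (RA RB P γ : ℝ) (hRA : 0 < RA) (hRB : 0 < RB) (hP : 0 < P)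
    (K Qminus m RA' RB' yfee : ℝ)
    (hK : K = RA * RB) (hQ : Qminus = RB / RA) (hm : m = P / Qminus)
    (hRA' : RA' = Real.sqrt (K / (P * Real.exp γ)))
    (hRB' : RB' = Real.sqrt (K * (P * Real.exp γ)))
    (hfee : yfee = (1 - Real.exp (-γ)) * (RB - RB')) :
    P * RA' + RB' + yfee = RB * (2 * Real.exp (-γ / 2) * Real.sqrt m + 1 - Real.exp (-γ)) ∧
    (P * RA' + RB' + yfee) / (P * RA + RB) - 1 =
      (2 * Real.exp (-γ / 2) * Real.sqrt m - m - Real.exp (-γ)) / (m + 1) ∧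
    (P * RA' + RB' + yfee) / (P * RA + RB) - 1 =
      -((Real.sqrt m - Real.exp (-γ / 2)) ^ 2) / (m + 1) ∧
    (P * RA' + RB' + yfee) / (P * RA + RB) - 1 ≤ 0 ∧
    (m ≠ Real.exp (-γ) → (P * RA' + RB' + yfee) / (P * RA + RB) - 1 < 0) := by
  have hmP : m = P * RA / RB := by rw [hm, hQ]; field_simp
  have hmpos : 0 < m := by rw [hmP]; positivity
  obtain ⟨s, hs⟩ : ∃ s, s = Real.sqrt m := ⟨_, rfl⟩
  obtain ⟨t, ht⟩ : ∃ t, t = Real.exp (-γ / 2) := ⟨_, rfl⟩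
  have hspos : 0 < s := by rw [hs]; exact Real.sqrt_pos.mpr hmpos
  have htpos : 0 < t := by rw [ht]; exact Real.exp_pos _
  have hs2 : m = s ^ 2 := by rw [hs, Real.sq_sqrt hmpos.le]
  have ht2 : Real.exp (-γ) = t ^ 2 := by
    rw [ht, ← Real.exp_nat_mul]; congr 1; push_cast; ring
  have he : Real.exp γ = 1 / t ^ 2 := by
    rw [← ht2, Real.exp_neg]; simp
  have hPs : P = s ^ 2 * RB / RA := by
    rw [← hs2, hmP]; field_simp
  have hA : RA' = RA * t / s := by
    rw [hRA', hK, he, hPs, ← Real.sqrt_sq (show 0 ≤ RA * t / s by positivity)]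
    congr 1; field_simp
  have hB : RB' = RB * s / t := by
    rw [hRB', hK, he, hPs, ← Real.sqrt_sq (show 0 ≤ RB * s / t by positivity)]
    congr 1; field_simp
  rw [← hs, ← ht, ht2]
  have h1 : P * RA' + RB' + yfee = RB * (2 * t * s + 1 - t ^ 2) := by
    rw [hfee, ht2, hA, hB, hPs]; field_simp; ring
  have hden : P * RA + RB = RB * (m + 1) := by
    rw [hmP]; field_simp
  have hm1 : 0 < m + 1 := by linarith
  have h2 : (P * RA' + RB' + yfee) / (P * RA + RB) - 1 =
      (2 * t * s - m - t ^ 2) / (m + 1) := by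
    rw [h1, hden]; field_simp; ring
  have h3 : (P * RA' + RB' + yfee) / (P * RA + RB) - 1 = -((s - t) ^ 2) / (m + 1) := by
    rw [h2]; congr 1; rw [hs2]; ring
  refine ⟨h1, h2, h3, ?_, ?_⟩
  · rw [h3]
    exact div_nonpos_of_nonpos_of_nonneg (neg_nonpos.mpr (sq_nonneg _)) hm1.le
  · intro hne
    rw [h3]
    refine div_neg_of_neg_of_pos (neg_neg_of_pos ?_) hm1
    have : s - t ≠ 0 := by
      intro h
      apply hne
      rw [hs2, sub_eq_zero.mp h]
    positivity
end

section
/- Let (Ω, 𝔽, μ) be a probability space, let J⁻, J⁺ : Ω → ℝ be measurable with J⁻ < 0 and J⁺ < 0 almost surely, and let 0 ≤ θ_min < θ_max be such that 1 + θ·J⁻ > 0 and 1 + θ·J⁺ > 0 almost surely for every θ ∈ [θ_min, θ_max]. Let η > 0 with η ≠ 1, let r* > 0, λ⁻, λ⁺ ≥ 0, and let μ₀, σ ∈ ℝ. Assume (1 + θ·J⁻)^{1−η} and (1 + θ·J⁺)^{1−η} are integrable for every θ ∈ [θ_min, θ_max]. Define Φ(θ) = μ₀ − r*·θ − (η/2)·σ²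 + (λ⁻/(1−η))·E[(1 + θ·J⁻)^{1−η} − 1] + (λ⁺/(1−η))·E[(1 + θ·J⁺)^{1−η} − 1]. Then Φ is strictly decreasing on [θ_min, θ_max]; in particular, θ_min is the unique maximizer of Φ on [θ_min, θ_max]. -/
open MeasureTheory Real

theorem jump_term_anti {Ω : Type*} [MeasurableSpace Ω] (μ : Measure Ω) [IsProbabilityMeasure μ]
    (J : Ω → ℝ) (hJ : ∀ᵐ ω ∂μ, J ω < 0) (η l a b : ℝ) (hη1 : η ≠ 1) (hl : 0 ≤ l) (hab : a < b)
    (hb : ∀ᵐ ω ∂μ, 0 < 1 + b * J ω)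
    (hia : Integrable (fun ω => (1 + a * J ω) ^ (1 - η)) μ)
    (hib : Integrable (fun ω => (1 + b * J ω) ^ (1 - η)) μ) :
    l / (1 - η) * ∫ ω, ((1 + b * J ω) ^ (1 - η) - 1) ∂μ
      ≤ l / (1 - η) * ∫ ω, ((1 + a * J ω) ^ (1 - η) - 1) ∂μ := by
  have hia' := hia.sub (integrable_const (1 : ℝ))
  have hib' := hib.sub (integrable_const (1 : ℝ))
  rcases lt_or_gt_of_ne hη1 with h | h
  · apply mul_le_mul_of_nonneg_left _ (div_nonneg hl (by linarith))
    apply integral_mono_ae hib' hia'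
    filter_upwards [hJ, hb] with ω h1 h2
    have h3 : 1 + b * J ω ≤ 1 + a * J ω := by nlinarith
    have := Real.rpow_le_rpow h2.le h3 (show 0 ≤ 1 - η by linarith)
    simpa using this
  · apply mul_le_mul_of_nonpos_left _ (div_nonpos_of_nonneg_of_nonpos hl (by linarith))
    apply integral_mono_ae hia' hib'
    filter_upwards [hJ, hb] with ω h1 h2
    have h3 : 1 + b * J ω ≤ 1 + a * J ω := by nlinarith
    have := Real.rpow_le_rpow_of_nonpos h2 h3 (show 1 - η ≤ 0 by linarith)
    simpa using this

/-- With only informed arbitrage (`J⁻ < 0`, `J⁺ < 0` a.s.), positive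
financing rate `r* > 0` and `θ_min ≥ 0`, the reduced CRRA objective `Φ` is strictly
decreasing on `[θ_min, θ_max]`; in particular `θ_min` is its unique maximizer. -/
theorem minimal_liquidity_dominates
    {Ω : Type*} [MeasurableSpace Ω] (μ : Measure Ω) [IsProbabilityMeasure μ]
    (Jm Jp : Ω → ℝ) (hJm_meas : Measurable Jm) (hJp_meas : Measurable Jp)
    (hJm_neg : ∀ᵐ ω ∂μ, Jm ω < 0) (hJp_neg : ∀ᵐ ω ∂μ, Jp ω < 0)
    (θmin θmax : ℝ) (hθmin : 0 ≤ θmin) (hθ : θmin < θmax)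
    (hpos_m : ∀ θ ∈ Set.Icc θmin θmax, ∀ᵐ ω ∂μ, 0 < 1 + θ * Jm ω)
    (hpos_p : ∀ θ ∈ Set.Icc θmin θmax, ∀ᵐ ω ∂μ, 0 < 1 + θ * Jp ω)
    (η : ℝ) (hη : 0 < η) (hη1 : η ≠ 1)
    (rstar : ℝ) (hr : 0 < rstar)
    (lm lp : ℝ) (hlm : 0 ≤ lm) (hlp : 0 ≤ lp)
    (μ0 σ : ℝ)
    (hint_m : ∀ θ ∈ Set.Icc θmin θmax,
      Integrable (fun ω => (1 + θ * Jm ω) ^ (1 - η)) μ)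
    (hint_p : ∀ θ ∈ Set.Icc θmin θmax,
      Integrable (fun ω => (1 + θ * Jp ω) ^ (1 - η)) μ)
    (Φ : ℝ → ℝ)
    (hΦ : Φ = fun θ => μ0 - rstar * θ - η / 2 * σ ^ 2
      + lm / (1 - η) * ∫ ω, ((1 + θ * Jm ω) ^ (1 - η) - 1) ∂μ
      + lp / (1 - η) * ∫ ω, ((1 + θ * Jp ω) ^ (1 - η) - 1) ∂μ) :
    StrictAntiOn Φ (Set.Icc θmin θmax) ∧
    (∀ θ ∈ Set.Icc θmin θmax, θ ≠ θmin → Φ θ < Φ θmin) := by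
  have key : StrictAntiOn Φ (Set.Icc θmin θmax) := by
    intro a ha b hb hab
    have h1 := jump_term_anti μ Jm hJm_neg η lm a b hη1 hlm hab (hpos_m b hb)
      (hint_m a ha) (hint_m b hb)
    have h2 := jump_term_anti μ Jp hJp_neg η lp a b hη1 hlp hab (hpos_p b hb)
      (hint_p a ha) (hint_p b hb)
    have h3 := mul_lt_mul_of_pos_left hab hr
    rw [hΦ]
    beta_reduce
    linarith
  exact ⟨key, fun θ hm hne => key (Set.left_mem_Icc.mpr hθ.le) hm
    (lt_of_le_of_ne hm.1 (Ne.symm hne))⟩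
end

section
/- Let (Ω, 𝔽, μ) be a probability space, let J⁻, J⁺ : Ω → ℝ be measurable and bounded with J⁻ < 0 and J⁺ < 0 almost surely, and let θ_min < θ_max be such that 1 + θ·J⁻ ≥ ε and 1 + θ·J⁺ ≥ ε almost surely for every θ ∈ [θ_min, θ_max], for some ε > 0. Let η > 0 with η ≠ 1, r*, μ₀, σ ∈ ℝ, λ⁻, λ⁺ ≥ 0 with λ⁻ + λ⁺ > 0. Define Φ(θ) = μ₀ − r*·θ − (η/2)·σ² + (λ⁻/(1−η))·E[(1 + θ·J⁻)^{1−η} − 1] + (λ⁺/(1−η))·E[(1 + θ·J⁺)^{1−η} − 1]. Then Φ is strictly concave on [θ_min, θ_max]: for all θ₁ ≠ θ₂ in [θ_min, θ_max] and all t ∈ (0, 1), Φ(t·θ₁ + (1−t)·θ₂) > t·Φ(θ₁) + (1−t)·Φ(θ₂). -/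
open MeasureTheory Real

lemma aux_sc (p : ℝ) (hp : p < 1) (hp0 : p ≠ 0) :
    StrictConcaveOn ℝ (Set.Ioi (0:ℝ)) (fun x : ℝ => x ^ p / p) := by
  have hd : ∀ x ∈ Set.Ioi (0:ℝ), deriv (fun x : ℝ => x ^ p / p) x = x ^ (p - 1) := by
    intro x hx
    have h := ((Real.hasDerivAt_rpow_const (x := x) (p := p) (Or.inl (ne_of_gt hx))).div_const p).deriv
    rw [h]; field_simp
  apply StrictAntiOn.strictConcaveOn_of_deriv (convex_Ioi 0)
  · intro x hx
    exact ((Real.continuousAt_rpow_const x p (Or.inl (ne_of_gt hx))).div_const p).continuousWithinAt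
  · rw [interior_Ioi]
    intro x hx y hy hxy
    rw [hd x hx, hd y hy]
    exact Real.rpow_lt_rpow_of_neg hx hxy (by linarith)

lemma aux_int {Ω : Type*} [MeasurableSpace Ω] (μ : Measure Ω) [IsProbabilityMeasure μ]
    (J : Ω → ℝ) (hJ : Measurable J) (C : ℝ) (hC : ∀ ω, |J ω| ≤ C) (θ ε : ℝ) (hε : 0 < ε)
    (hpos : ∀ᵐ ω ∂μ, ε ≤ 1 + θ * J ω) (p : ℝ) :
    Integrable (fun ω => (1 + θ * J ω) ^ p - 1) μ := by
  refine Integrable.sub ?_ (integrable_const _)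
  refine Integrable.of_bound (C := ε ^ p + (1 + |θ| * C) ^ p)
    (Measurable.aestronglyMeasurable (by fun_prop)) ?_
  filter_upwards [hpos] with ω h
  have h0 : 0 < 1 + θ * J ω := by linarith
  have h1 : 1 + θ * J ω ≤ 1 + |θ| * C := by
    have := (le_abs_self (θ * J ω)).trans_eq (abs_mul _ _)
    have := mul_le_mul_of_nonneg_left (hC ω) (abs_nonneg θ)
    linarith
  have e1 : 0 ≤ ε ^ p := by positivity
  have e2 : 0 ≤ (1 + |θ| * C) ^ p := Real.rpow_nonneg (by linarith) _
  rw [Real.norm_of_nonneg (by positivity)]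
  rcases le_total 0 p with hp | hp
  · linarith [Real.rpow_le_rpow h0.le h1 hp]
  · linarith [Real.rpow_le_rpow_of_nonpos hε h hp]

lemma aux_main {Ω : Type*} [MeasurableSpace Ω] (μ : Measure Ω) [IsProbabilityMeasure μ]
    (J : Ω → ℝ) (hJ : Measurable J) (C : ℝ) (hC : ∀ ω, |J ω| ≤ C) (hneg : ∀ᵐ ω ∂μ, J ω < 0)
    (a b ε : ℝ) (hε : 0 < ε)
    (hpos : ∀ θ ∈ Set.Icc a b, ∀ᵐ ω ∂μ, ε ≤ 1 + θ * J ω) (p : ℝ) (hp : p < 1) (hp0 : p ≠ 0)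
    (x : ℝ) (hx : x ∈ Set.Icc a b) (y : ℝ) (hy : y ∈ Set.Icc a b) (hxy : x ≠ y)
    (t : ℝ) (ht : t ∈ Set.Ioo (0:ℝ) 1) :
    t * ((∫ ω, ((1 + x * J ω) ^ p - 1) ∂μ) / p) + (1 - t) * ((∫ ω, ((1 + y * J ω) ^ p - 1) ∂μ) / p)
      < (∫ ω, ((1 + (t * x + (1 - t) * y) * J ω) ^ p - 1) ∂μ) / p := by
  have hz : t * x + (1 - t) * y ∈ Set.Icc a b :=
    (convex_Icc a b) hx hy ht.1.le (by linarith [ht.2]) (by ring)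
  have ix := ((aux_int μ J hJ C hC x ε hε (hpos x hx) p).div_const p).const_mul t
  have iy := ((aux_int μ J hJ C hC y ε hε (hpos y hy) p).div_const p).const_mul (1 - t)
  have iz := (aux_int μ J hJ C hC _ ε hε (hpos _ hz) p).div_const p
  rw [← integral_div, ← integral_div, ← integral_div, ← integral_const_mul, ← integral_const_mul,
    ← integral_add ix iy, ← sub_pos, ← integral_sub iz (by exact ix.add iy)]
  have key : ∀ᵐ ω ∂μ, 0 < ((1 + (t * x + (1 - t) * y) * J ω) ^ p - 1) / p -
      (t * (((1 + x * J ω) ^ p - 1) / p) + (1 - t) * (((1 + y * J ω) ^ p - 1) / p)) := by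
    filter_upwards [hneg, hpos x hx, hpos y hy] with ω hn h1 h2
    have := (aux_sc p hp hp0).2 (x := 1 + x * J ω) (y := 1 + y * J ω)
      (Set.mem_Ioi.2 (by linarith)) (Set.mem_Ioi.2 (by linarith))
      (fun h => hxy (mul_right_cancel₀ hn.ne (add_left_cancel h))) ht.1 (sub_pos.2 ht.2) (by ring)
    simp only [smul_eq_mul] at this
    have e : t * (1 + x * J ω) + (1 - t) * (1 + y * J ω) = 1 + (t * x + (1 - t) * y) * J ω := by ring
    rw [e] at this
    simp only [sub_div]
    linarith
  refine (integral_pos_iff_support_of_nonneg_ae (key.mono fun ω h => h.le)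
    (iz.sub (ix.add iy))).2 ?_
  rw [pos_iff_ne_zero]
  intro h0
  have : ∀ᵐ ω ∂μ, False := by
    filter_upwards [key, measure_eq_zero_iff_ae_notMem.1 h0] with ω h1 h2
    exact h2 (Function.mem_support.2 h1.ne')
  simp at this
  exact IsProbabilityMeasure.ne_zero μ this

/-- Strict concavity of the reduced CRRA objective `Φ` on
`[θ_min, θ_max]` under bounded, a.s.-negative jump returns `J⁻, J⁺`, a uniform
lower bound `1 + θ·J^± ≥ ε > 0` on the admissible interval, and `λ⁻ + λ⁺ > 0`. -/
theorem reduced_objective_strictly_concave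
    {Ω : Type*} [MeasurableSpace Ω] (μ : Measure Ω) [IsProbabilityMeasure μ]
    (Jm Jp : Ω → ℝ) (hJm_meas : Measurable Jm) (hJp_meas : Measurable Jp)
    (Cm Cp : ℝ) (hJm_bdd : ∀ ω, |Jm ω| ≤ Cm) (hJp_bdd : ∀ ω, |Jp ω| ≤ Cp)
    (hJm_neg : ∀ᵐ ω ∂μ, Jm ω < 0) (hJp_neg : ∀ᵐ ω ∂μ, Jp ω < 0)
    (θmin θmax : ℝ) (hθ : θmin < θmax)
    (ε : ℝ) (hε : 0 < ε)
    (hpos_m : ∀ θ ∈ Set.Icc θmin θmax, ∀ᵐ ω ∂μ, ε ≤ 1 + θ * Jm ω)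
    (hpos_p : ∀ θ ∈ Set.Icc θmin θmax, ∀ᵐ ω ∂μ, ε ≤ 1 + θ * Jp ω)
    (η : ℝ) (hη : 0 < η) (hη1 : η ≠ 1)
    (rstar μ0 σ : ℝ)
    (lm lp : ℝ) (hlm : 0 ≤ lm) (hlp : 0 ≤ lp) (hl : 0 < lm + lp)
    (Φ : ℝ → ℝ)
    (hΦ : Φ = fun θ => μ0 - rstar * θ - η / 2 * σ ^ 2
      + lm / (1 - η) * ∫ ω, ((1 + θ * Jm ω) ^ (1 - η) - 1) ∂μ
      + lp / (1 - η) * ∫ ω, ((1 + θ * Jp ω) ^ (1 - η) - 1) ∂μ) :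
    ∀ θ₁ ∈ Set.Icc θmin θmax, ∀ θ₂ ∈ Set.Icc θmin θmax, θ₁ ≠ θ₂ →
      ∀ t : ℝ, t ∈ Set.Ioo (0 : ℝ) 1 →
        t * Φ θ₁ + (1 - t) * Φ θ₂ < Φ (t * θ₁ + (1 - t) * θ₂) := by
  intro x hx y hy hxy t ht
  have hp : 1 - η < 1 := by linarith
  have hp0 : 1 - η ≠ 0 := fun h => hη1 (by linarith)
  have A := aux_main μ Jm hJm_meas Cm hJm_bdd hJm_neg θmin θmax ε hε hpos_m (1 - η) hp hp0
    x hx y hy hxy t ht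
  have B := aux_main μ Jp hJp_meas Cp hJp_bdd hJp_neg θmin θmax ε hε hpos_p (1 - η) hp hp0
    x hx y hy hxy t ht
  subst hΦ
  simp only [div_mul_eq_mul_div, mul_div_assoc lm, mul_div_assoc lp]
  rcases hlm.lt_or_eq with h | h
  · have A' := mul_lt_mul_of_pos_left A h
    have B' := mul_le_mul_of_nonneg_left B.le hlp
    linarith
  · have A' := mul_le_mul_of_nonneg_left A.le hlm
    have B' := mul_lt_mul_of_pos_left B (show 0 < lp by linarith)
    linarith
end

section
/- Let σ > 0, K > 0, g ≥ 0, Q > 0 and γ ∈ ℝ, let ξ be a real Gaussian random variable with mean 0 and variance σ², set a = √(2g/K) and q = K·ξ·1{|ξ| ≥ a}. Then the expected paid-out noise fee satisfies E[ Q·( (e^{γ} − 1)·max(q, 0) + (1 − e^{-γ})·max(−q, 0) ) ] = Q·(e^{γ} − e^{-γ})·K·σ·φ(a/σ), where φ(x) = (1/√(2π))·e^{−x²/2} is the standard normal density. In particular E[max(q,0)] = E[max(−q,0)] = (1/2)·E[|q|]. -/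
open MeasureTheory ProbabilityTheory Real

/-- Expected paid-out noise fee: with `ξ ~ N(0, σ²)`,
`a = √(2g/K)` and the executed trade `q(ξ) = K·ξ·1{|ξ| ≥ a}`,
`E[Q·((e^γ − 1)·q⁺ + (1 − e^{-γ})·q⁻)] = Q·(e^γ − e^{-γ})·K·σ·φ(a/σ)`, and the
buy and sell sides are symmetric: `E[q⁺] = E[q⁻] = (1/2)·E[|q|]`. -/
theorem expected_noise_fee
    (σ K g Q γ : ℝ) (hσ : 0 < σ) (hK : 0 < K) (hg : 0 ≤ g) (hQ : 0 < Q)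
    (a : ℝ) (ha : a = Real.sqrt (2 * g / K))
    (q : ℝ → ℝ) (hq : q = fun x => K * x * Set.indicator {y : ℝ | a ≤ |y|} 1 x)
    (φ : ℝ → ℝ)
    (hφ : φ = fun x => (1 / Real.sqrt (2 * Real.pi)) * Real.exp (-x ^ 2 / 2)) :
    (∫ x, Q * ((Real.exp γ - 1) * max (q x) 0 + (1 - Real.exp (-γ)) * max (-q x) 0)
        ∂(gaussianReal 0 (Real.toNNReal (σ ^ 2)))
      = Q * (Real.exp γ - Real.exp (-γ)) * K * σ * φ (a / σ)) ∧
    (∫ x, max (q x) 0 ∂(gaussianReal 0 (Real.toNNReal (σ ^ 2)))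
      = ∫ x, max (-q x) 0 ∂(gaussianReal 0 (Real.toNNReal (σ ^ 2)))) ∧
    (∫ x, max (q x) 0 ∂(gaussianReal 0 (Real.toNNReal (σ ^ 2)))
      = (1 / 2) * ∫ x, |q x| ∂(gaussianReal 0 (Real.toNNReal (σ ^ 2)))) := by
  have ha0 : 0 ≤ a := by rw [ha]; exact Real.sqrt_nonneg _
  have hv : Real.toNNReal (σ ^ 2) ≠ 0 := by
    have : 0 < Real.toNNReal (σ ^ 2) := Real.toNNReal_pos.mpr (by positivity)
    exact this.ne'
  have hvc : ((Real.toNNReal (σ ^ 2) : NNReal) : ℝ) = σ ^ 2 := Real.coe_toNNReal _ (by positivity)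
  set μ := gaussianReal 0 (Real.toNNReal (σ ^ 2)) with hμ
  have hmeas : Measurable q := by
    rw [hq]
    have hs : MeasurableSet {y : ℝ | a ≤ |y|} :=
      measurableSet_le measurable_const (by fun_prop)
    exact (measurable_id.const_mul K).mul (measurable_one.indicator hs)
  have hodd : ∀ x, q (-x) = - q x := by
    intro x
    rw [hq]
    by_cases h : a ≤ |x| <;> simp [Set.indicator, h]
  have hbound : ∀ x, |q x| ≤ |K * x| := by
    intro x
    rw [hq]
    by_cases h : a ≤ |x|
    · simp [Set.indicator, h]
    · simp [Set.indicator, h]; positivity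
  have hid : Integrable (fun x : ℝ => K * x) μ := by
    have h : MemLp id 1 μ := memLp_id_gaussianReal' 1 (by simp)
    exact (memLp_one_iff_integrable.mp h).const_mul K
  have hqi : Integrable q μ :=
    hid.mono hmeas.aestronglyMeasurable (Filter.Eventually.of_forall hbound)
  have hp : Integrable (fun x => max (q x) 0) μ := hqi.pos_part
  have hn : Integrable (fun x => max (-q x) 0) μ := hqi.neg_part
  have hsymm : ∫ x, max (q x) 0 ∂μ = ∫ x, max (-q x) 0 ∂μ := by
    have hmap : μ.map (fun x => -x) = μ := by
      rw [hμ, gaussianReal_map_neg, neg_zero]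
    have h1 : ∫ x, max (q x) 0 ∂(μ.map (fun x => -x)) = ∫ x, max (q (-x)) 0 ∂μ :=
      integral_map (by fun_prop) (by fun_prop)
    rw [hmap] at h1
    simpa only [hodd] using h1
  have habs : ∫ x, |q x| ∂μ = ∫ x, max (q x) 0 ∂μ + ∫ x, max (-q x) 0 ∂μ := by
    rw [← integral_add hp hn]
    congr 1
    ext x
    rcases le_total 0 (q x) with h | h
    · rw [abs_of_nonneg h, max_eq_left h, max_eq_right (by linarith)]; ring
    · rw [abs_of_nonpos h, max_eq_right h, max_eq_left (by linarith)]; ring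
  have hval : ∫ x, max (q x) 0 ∂μ = K * σ * φ (a / σ) := by
    rw [hμ, integral_gaussianReal_eq_integral_smul hv]
    have hmax : ∀ x, gaussianPDFReal 0 (Real.toNNReal (σ ^ 2)) x • max (q x) 0
        = Set.indicator (Set.Ici a)
          (fun x => K * x * gaussianPDFReal 0 (Real.toNNReal (σ ^ 2)) x) x := by
      intro x
      rw [hq]
      by_cases h : a ≤ x
      · have hx : 0 ≤ x := ha0.trans h
        have : a ≤ |x| := by rwa [abs_of_nonneg hx]
        have hKx : 0 ≤ K * x := by positivity
        simp [Set.indicator, h, this, hKx]; ring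
      · by_cases h' : a ≤ |x|
        · have hx : x ≤ 0 := by
            by_contra hc
            rw [abs_of_pos (not_le.mp hc)] at h'
            exact h h'
          have hKx : K * x ≤ 0 := mul_nonpos_of_nonneg_of_nonpos hK.le hx
          simp [Set.indicator, h, h', hKx]
        · simp [Set.indicator, h, h']
    simp_rw [hmax]
    rw [integral_indicator measurableSet_Ici, integral_Ici_eq_integral_Ioi]
    have hF : ∀ x ∈ Set.Ici a, HasDerivAt
        (fun x => -(K * σ * (1 / Real.sqrt (2 * Real.pi))) * Real.exp (-x ^ 2 / (2 * σ ^ 2)))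
        (K * x * gaussianPDFReal 0 (Real.toNNReal (σ ^ 2)) x) x := by
      intro x _
      have h1 : HasDerivAt (fun x : ℝ => -x ^ 2 / (2 * σ ^ 2)) (-(2 * x) / (2 * σ ^ 2)) x := by
        simpa using ((hasDerivAt_pow 2 x).neg.div_const (2 * σ ^ 2))
      refine (h1.exp.const_mul _).congr_deriv ?_
      rw [gaussianPDFReal, hvc, Real.sqrt_mul (x := 2 * Real.pi) (by positivity) (σ ^ 2), Real.sqrt_sq hσ.le, sub_zero]
      field_simp
    have hlim : Filter.Tendsto
        (fun x => -(K * σ * (1 / Real.sqrt (2 * Real.pi))) * Real.exp (-x ^ 2 / (2 * σ ^ 2)))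
        Filter.atTop (nhds 0) := by
      have h2 : Filter.Tendsto (fun x : ℝ => -x ^ 2 / (2 * σ ^ 2)) Filter.atTop Filter.atBot := by
        have h3 : Filter.Tendsto (fun x : ℝ => x ^ 2 / (2 * σ ^ 2)) Filter.atTop Filter.atTop :=
          (Filter.tendsto_pow_atTop two_ne_zero).atTop_div_const (by positivity)
        refine (Filter.tendsto_neg_atTop_atBot.comp h3).congr ?_
        intro x
        simp [neg_div]
      simpa using (Real.tendsto_exp_atBot.comp h2).const_mul
        (-(K * σ * (1 / Real.sqrt (2 * Real.pi))))
    rw [integral_Ioi_of_hasDerivAt_of_nonneg' hF ?_ hlim]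
    · rw [hφ]
      have : -a ^ 2 / (2 * σ ^ 2) = -(a / σ) ^ 2 / 2 := by field_simp
      simp only [this]
      ring
    · intro x hx
      have hx0 : 0 ≤ x := ha0.trans (le_of_lt hx)
      have := gaussianPDFReal_nonneg 0 (Real.toNNReal (σ ^ 2)) x
      positivity
  refine ⟨?_, hsymm, ?_⟩
  · rw [integral_const_mul, integral_add (hp.const_mul _) (hn.const_mul _),
      integral_const_mul, integral_const_mul, ← hsymm, hval]
    ring
  · rw [habs, ← hsymm]; ring
end
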